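/- Let k be a perfect field, n ≥ 1, and let G be a finite group such that: (1) ed_k(G; ≤ n) = 1; (2) G has no proper subgroup of index at most n; and (3) G contains a subgroup M that embeds into PSL_2(k) with |M| > n. Then there exists a smooth, irreducible, projective curve C̃ over k with a faithful G-action admitting a rational function f : C̃ → P^1 of degree m for some m ≤ n. -/

import Mathlib

open IntermediateField Multiplicative

/-- `K` is (the function field of) an irreducible variety over `k`:
a finitely generated field extension of `k`. -/
def IsFunctionField (k K : Type) [Field k] [Field K] [Algebra k K] : Prop :=
  ∃ s : Finset K, IntermediateField.adjoin k (s : Set K) = ⊤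

/-- The variety with function field `K` has dimension at most `d`, i.e. the
transcendence degree of `K/k` is at most `d`. -/
def DimLE (k K : Type) [Field k] [Field K] [Algebra k K] (d : ℕ) : Prop :=
  ∃ s : Finset K, s.card ≤ d ∧ Algebra.IsAlgebraic (IntermediateField.adjoin k (s : Set K)) K

/-- `K` is the function field of an irreducible algebraic curve over `k`: a finitely
generated field extension of `k` of transcendence degree one. -/
def IsCurveField (k K : Type) [Field k] [Field K] [Algebra k K] : Prop :=
  IsFunctionField k K ∧ DimLE k K 1 ∧ ∃ x : K, Transcendental k x

/-- The rational function `f` on the curve with function field `K` has degree `n`,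
i.e. the corresponding dominant rational map to `P¹` is generically `n`-to-1:
`[K : k(f)] = n` (in particular this extension is finite). -/
def RatFnDegree (k K : Type) [Field k] [Field K] [Algebra k K] (f : K) (n : ℕ) : Prop :=
  FiniteDimensional (IntermediateField.adjoin k ({f} : Set K)) K ∧
    Module.finrank (IntermediateField.adjoin k ({f} : Set K)) K = n

/-- A faithful `G`-variety over `k`, in birational terms: a finitely generated
field extension `K/k` (the function field) equipped with a faithful `G`-action
on `K` by `k`-automorphisms (i.e. a faithful action on the variety by birational
automorphisms). -/
structure GVariety (k : Type) [Field k] (G : Type) [Group G] where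
  K : Type
  [field : Field K]
  [algebra : Algebra k K]
  fg : IsFunctionField k K
  action : G →* (K ≃ₐ[k] K)
  faithful : Function.Injective action

attribute [instance] GVariety.field GVariety.algebra

section ED

variable {k : Type} [Field k] {G : Type} [Group G]

/-- A `G`-compression `X ⇢ Y`: a dominant rational `G`-map, i.e. a `G`-equivariant
`k`-embedding of function fields `k(Y) ↪ k(X)`. -/
def GVariety.Compression (X Y : GVariety k G) : Prop :=
  ∃ φ : Y.K →ₐ[k] X.K, ∀ (g : G) (y : Y.K), X.action g (φ y) = φ (Y.action g y)

/-- `T ⇢ X` is a `G`-equivariant branched cover of degree at most `n`: a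
`G`-equivariant `k`-embedding of function fields `k(X) ↪ k(T)` with
`[k(T) : k(X)] ≤ n`. -/
def GVariety.IsCoverDegLE (T X : GVariety k G) (n : ℕ) : Prop :=
  ∃ ι : X.K →ₐ[k] T.K,
    FiniteDimensional ι.fieldRange T.K ∧ Module.finrank ι.fieldRange T.K ≤ n ∧
    ∀ (g : G) (x : X.K), T.action g (ι x) = ι (X.action g x)

end ED

/-- `ed_k(G; ≤ n) ≤ d`: every faithful `G`-variety `X` over `k` admits a
`G`-equivariant branched cover `X̃ ⇢ X` of degree at most `n` together with a
`G`-compression `X̃ ⇢ Y` to a faithful `G`-variety `Y` of dimension at most `d`.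
Thus `ed_k(G; ≤ n) > d` is the negation `¬ EDLE k G n d`. -/
def EDLE (k : Type) [Field k] (G : Type) [Group G] (n d : ℕ) : Prop :=
  ∀ X : GVariety k G, ∃ T Y : GVariety k G,
    T.IsCoverDegLE X n ∧ T.Compression Y ∧ DimLE k Y.K d

/-- Gauss's lemma for the extension of a valuation to polynomials by the maximum of the values of
the coefficients. -/
theorem ValuationSubring.mul_le_of_forall_coeff_mul_le {K σ : Type*} [Field K]
    (V : ValuationSubring K) {p g : MvPolynomial σ K} {δ : V.ValueGroup}
    (h : ∀ m, V.valuation ((p * g).coeff m) ≤ δ) (i j : σ →₀ ℕ) :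
    V.valuation (p.coeff i) * V.valuation (g.coeff j) ≤ δ := by
  classical
  have key : ∀ q : MvPolynomial σ K, q ≠ 0 → ∃ (a : K) (q' : MvPolynomial σ V), a ≠ 0 ∧
      q = MvPolynomial.C a * MvPolynomial.map (algebraMap V K) q' ∧
      MvPolynomial.map (IsLocalRing.residue V) q' ≠ 0 ∧
      ∀ m, V.valuation (q.coeff m) ≤ V.valuation a := by
    intro q hq
    obtain ⟨m₀, hm₀, hmax⟩ := q.support.exists_max_image (fun m ↦ V.valuation (q.coeff m))
      (MvPolynomial.support_nonempty.mpr hq)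
    have ha : q.coeff m₀ ≠ 0 := MvPolynomial.mem_support_iff.mp hm₀
    have hle : ∀ m, V.valuation (q.coeff m) ≤ V.valuation (q.coeff m₀) := by
      intro m
      by_cases hm : m ∈ q.support
      · exact hmax m hm
      · rw [MvPolynomial.notMem_support_iff.mp hm, map_zero]
        exact zero_le
    have hmem : MvPolynomial.C (q.coeff m₀)⁻¹ * q ∈
        Set.range (MvPolynomial.map (σ := σ) (algebraMap V K)) := by
      rw [MvPolynomial.mem_range_map_iff_coeffs_subset]
      intro x hx
      obtain ⟨m, -, rfl⟩ := MvPolynomial.mem_coeffs_iff.mp hx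
      refine ⟨⟨MvPolynomial.coeff m (MvPolynomial.C (q.coeff m₀)⁻¹ * q), ?_⟩, rfl⟩
      rw [← V.valuation_le_one_iff, MvPolynomial.coeff_C_mul, map_mul, map_inv₀]
      exact inv_mul_le_one_of_le₀ (hle m) zero_le
    obtain ⟨q', hq'⟩ := hmem
    refine ⟨q.coeff m₀, q', ha, ?_, ?_, hle⟩
    · rw [hq', ← mul_assoc, ← map_mul, mul_inv_cancel₀ ha, map_one, one_mul]
    · intro h0
      have h1 : q'.coeff m₀ = 1 := by
        apply FaithfulSMul.algebraMap_injective V K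
        rw [← MvPolynomial.coeff_map, hq', MvPolynomial.coeff_C_mul, inv_mul_cancel₀ ha, map_one]
      have := congrArg (MvPolynomial.coeff m₀) h0
      rw [MvPolynomial.coeff_map, h1] at this
      simp at this
  by_cases hp : p = 0
  · simp [hp]
  by_cases hg : g = 0
  · simp [hg]
  obtain ⟨a, p', -, hp', hp0, hpa⟩ := key p hp
  obtain ⟨b, g', -, hg', hg0, hgb⟩ := key g hg
  obtain ⟨m, hm⟩ := MvPolynomial.ne_zero_iff.mp (mul_ne_zero hp0 hg0)
  rw [← map_mul, MvPolynomial.coeff_map] at hm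
  have hunit : IsUnit ((p' * g').coeff m) := by
    by_contra hn
    exact hm (Ideal.Quotient.eq_zero_iff_mem.mpr hn)
  have hv : V.valuation ((p * g).coeff m) = V.valuation a * V.valuation b := by
    have : p * g = MvPolynomial.C (a * b) * MvPolynomial.map (algebraMap V K) (p' * g') := by
      rw [hp', hg', map_mul, map_mul]; ring
    have hone : V.valuation (algebraMap V K ((p' * g').coeff m)) = 1 :=
      (V.valuation_eq_one_iff _).mp hunit
    rw [this, MvPolynomial.coeff_C_mul, MvPolynomial.coeff_map, map_mul, map_mul, hone, mul_one]
  exact (mul_le_mul' (hpa i) (hgb j)).trans (hv ▸ h m)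

theorem isAlgebraic_of_not_algebraicIndependent {k K A σ : Type*} [Field k] [Field K]
    [CommRing A] [IsDomain A] [Algebra k K] [Algebra K A] [Algebra k A] [IsScalarTower k K A]
    (htr : ∀ x : K, Transcendental k x → Algebra.IsAlgebraic (Algebra.adjoin k {x}) K)
    {t : σ → A} (ht : AlgebraicIndependent k t) (hnt : ¬ AlgebraicIndependent K t) (y : K) :
    IsAlgebraic (Algebra.adjoin k (Set.range t)) (algebraMap K A y) := by
  by_cases hy : IsAlgebraic k y
  · exact ((hy.algebraMap (A := A))).extendScalars
      (FaithfulSMul.algebraMap_injective k (Algebra.adjoin k (Set.range t)))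
  by_contra hty
  apply hnt
  have := htr y hy
  have h1 := (ht.option_iff_transcendental (algebraMap K A y)).mpr hty
  have h2 : AlgebraicIndependent k
      (Sum.elim t (fun _ : Unit ↦ algebraMap K A y)) := by
    refine (algebraicIndependent_equiv' (Equiv.optionEquivSumPUnit σ).symm ?_).mpr h1
    ext (_ | i) <;> simp
  have h3 := (AlgebraicIndependent.sumElim_iff.mp h2).2
  suffices h4 : AlgebraicIndependent (Algebra.adjoin k {y}) t from h4.extendScalars K
  have himg : ∀ z : Algebra.adjoin k {y}, algebraMap K A z ∈
      Algebra.adjoin k (Set.range fun _ : Unit ↦ algebraMap K A y) := by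
    intro z
    have : (IsScalarTower.toAlgHom k K A) (z : K) ∈
        (Algebra.adjoin k {y}).map (IsScalarTower.toAlgHom k K A) :=
      ⟨z, z.2, rfl⟩
    rw [AlgHom.map_adjoin_singleton] at this
    simpa using this
  let f : Algebra.adjoin k {y} →+* Algebra.adjoin k (Set.range fun _ : Unit ↦ algebraMap K A y) :=
    ((algebraMap K A).comp (algebraMap (Algebra.adjoin k {y}) K)).codRestrict _ himg
  have hf : Function.Injective f := by
    intro a b hab
    exact Subtype.ext ((algebraMap K A).injective (congrArg Subtype.val hab))
  exact AlgebraicIndependent.of_ringHom_of_comp_eq (f := f) (g := RingHom.id A) h3 hf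
    (by ext; rfl)

theorem exists_dvd_iff_aeval_eq_zero {k K L σ : Type*} [Field k] [Field K]
    [Field L] [Algebra k K] [Algebra K L] [Algebra k L] [IsScalarTower k K L]
    (htr : ∀ x : K, Transcendental k x → Algebra.IsAlgebraic (Algebra.adjoin k {x}) K)
    {t : σ → L} (ht : AlgebraicIndependent k t) (hnt : ¬ AlgebraicIndependent K t) :
    ∃ p : MvPolynomial σ K, p ≠ 0 ∧ ∀ q, MvPolynomial.aeval t q = 0 ↔ p ∣ q := by
  obtain ⟨q₀, hq₀, hq₀0⟩ : ∃ q : MvPolynomial σ K, MvPolynomial.aeval t q = 0 ∧ q ≠ 0 := by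
    simpa [algebraicIndependent_iff] using hnt
  obtain ⟨p, hp, hpt⟩ : ∃ p : MvPolynomial σ K, Prime p ∧ MvPolynomial.aeval t p = 0 := by
    have hprime : (RingHom.ker (MvPolynomial.aeval (R := K) t)).IsPrime := RingHom.ker_isPrime _
    obtain ⟨p, hp, hpp⟩ := hprime.exists_mem_prime_of_ne_bot
      (fun h ↦ hq₀0 (by rw [← Ideal.mem_bot, ← h]; exact hq₀))
    exact ⟨p, hpp, hp⟩
  refine ⟨p, hp.ne_zero, fun q ↦ ⟨fun hq ↦ ?_, fun ⟨r, hr⟩ ↦ by rw [hr, map_mul, hpt, zero_mul]⟩⟩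
  by_contra hpq
  let J : Ideal (MvPolynomial σ K) := Ideal.span {p}
  have hJ : J.IsPrime := (Ideal.span_singleton_prime hp.ne_zero).mpr hp
  let t' : σ → MvPolynomial σ K ⧸ J := fun i ↦ Ideal.Quotient.mk J (MvPolynomial.X i)
  have haeval : ∀ r : MvPolynomial σ K, MvPolynomial.aeval t' r = Ideal.Quotient.mk J r := by
    intro r
    have : MvPolynomial.aeval (R := K) t' = Ideal.Quotient.mkₐ K J := by
      ext i
      simp [t']
    rw [this]; rfl
  have haevalk : ∀ s : MvPolynomial σ k, MvPolynomial.aeval t' s =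
      Ideal.Quotient.mk J (MvPolynomial.map (algebraMap k K) s) := by
    intro s
    rw [← haeval, MvPolynomial.aeval_map_algebraMap]
  have ht' : AlgebraicIndependent k t' := by
    rw [algebraicIndependent_iff]
    intro s hs
    rw [haevalk, Ideal.Quotient.eq_zero_iff_mem, Ideal.mem_span_singleton] at hs
    obtain ⟨r, hr⟩ := hs
    apply ht.eq_zero_of_aeval_eq_zero
    rw [← MvPolynomial.aeval_map_algebraMap K, hr, map_mul, hpt, zero_mul]
  have hnt' : ¬ AlgebraicIndependent K t' := by
    intro h
    apply hp.ne_zero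
    apply h.eq_zero_of_aeval_eq_zero
    rw [haeval, Ideal.Quotient.eq_zero_iff_mem]
    exact Ideal.mem_span_singleton_self p
  have halg : ∀ r, IsAlgebraic (Algebra.adjoin k (Set.range t')) (Ideal.Quotient.mk J r) := by
    intro r
    induction r using MvPolynomial.induction_on with
    | C a => exact isAlgebraic_of_not_algebraicIndependent htr ht' hnt' a
    | add f g hf hg => rw [map_add]; exact hf.add hg
    | mul_X f i hf =>
      rw [map_mul]
      exact hf.mul (isAlgebraic_algebraMap
        (⟨t' i, Algebra.subset_adjoin ⟨i, rfl⟩⟩ : Algebra.adjoin k (Set.range t')))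
  obtain ⟨⟨r, hr⟩, hr0, w, hw⟩ := (halg q).exists_nonzero_dvd
    (mem_nonZeroDivisors_of_ne_zero (by
      rwa [Ne, Ideal.Quotient.eq_zero_iff_mem, Ideal.mem_span_singleton]))
  obtain ⟨s, rfl⟩ := (Algebra.adjoin_range_eq_range_aeval k t' ▸ hr :)
  obtain ⟨w, rfl⟩ := Ideal.Quotient.mk_surjective w
  change MvPolynomial.aeval t' s = _ at hw
  rw [haevalk, ← map_mul, Ideal.Quotient.eq, Ideal.mem_span_singleton] at hw
  obtain ⟨u, hu⟩ := hw
  apply_fun MvPolynomial.aeval t at hu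
  rw [map_sub, map_mul, map_mul, hpt, hq, zero_mul, zero_mul, sub_zero,
    MvPolynomial.aeval_map_algebraMap] at hu
  refine hr0 (Subtype.ext ?_)
  change MvPolynomial.aeval t' s = 0
  rw [ht.eq_zero_of_aeval_eq_zero s hu, map_zero]

section

/-- The elements of `K` with poles bounded by `N - 1` times the polar divisor of `c`. -/
def poleSpace (k : Type*) {K : Type*} [Field k] [Field K] [Algebra k K] (c : K) (N : ℕ) :
    Submodule k K where
  carrier := {x | ∀ V : ValuationSubring K, (∀ a : k, algebraMap k K a ∈ V) →
    V.valuation x * max 1 (V.valuation c) ≤ max 1 (V.valuation c) ^ N}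
  add_mem' := by
    intro x y hx hy V hV
    rcases le_max_iff.mp (V.valuation.map_add x y) with h | h
    · exact (mul_le_mul_left h _).trans (hx V hV)
    · exact (mul_le_mul_left h _).trans (hy V hV)
  zero_mem' := by
    intro V hV
    rw [map_zero, zero_mul]
    exact zero_le
  smul_mem' := by
    intro a x hx V hV
    rw [Algebra.smul_def, map_mul, mul_assoc]
    exact (mul_le_of_le_one_left' ((V.valuation_le_one_iff _).mpr (hV a))).trans (hx V hV)

variable {k K : Type*} [Field k] [Field K] [Algebra k K]

theorem isIntegral_of_forall_mem_valuationSubring {x : K}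
    (h : ∀ V : ValuationSubring K, (∀ a : k, algebraMap k K a ∈ V) → x ∈ V) : IsIntegral k x := by
  by_contra hx
  have : IsIntegrallyClosedIn (integralClosure k K).toSubring K :=
    inferInstanceAs (IsIntegrallyClosedIn (integralClosure k K) K)
  obtain ⟨V, hV, hxV⟩ := Subring.exists_le_valuationSubring_of_isIntegrallyClosedIn
    (R := (integralClosure k K).toSubring) hx
  exact hxV (h V fun a ↦ hV (isIntegral_algebraMap (R := k) (x := a)))

theorem poleSpace_mono (c : K) :
    Monotone (poleSpace k c) :=
  fun _ _ h _ hx V hV ↦ (hx V hV).trans (pow_le_pow_right₀ (le_max_left _ _) h)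

theorem poleSpace_zero {c : K} (hc : Transcendental k c) : poleSpace k c 0 = ⊥ := by
  rw [eq_bot_iff]
  intro x hx
  have hle : ∀ (V : ValuationSubring K), (∀ a : k, algebraMap k K a ∈ V) →
      V.valuation x * max 1 (V.valuation c) ≤ 1 := fun V hV ↦ by simpa using hx V hV
  have h1 : IsIntegral k x := isIntegral_of_forall_mem_valuationSubring fun V hV ↦ by
    rw [← V.valuation_le_one_iff]
    exact (le_mul_of_one_le_right' (le_max_left _ _)).trans (hle V hV)
  have h2 : IsIntegral k (x * c) := isIntegral_of_forall_mem_valuationSubring fun V hV ↦ by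
    rw [← V.valuation_le_one_iff, map_mul]
    exact (mul_le_mul_right (le_max_right _ _) _).trans (hle V hV)
  by_contra hx0
  apply hc
  have hx0 : x ≠ 0 := hx0
  have : c = x⁻¹ * (x * c) := by field_simp
  rw [this]
  exact h1.isAlgebraic.inv.mul h2.isAlgebraic

theorem coeff_mem_poleSpace {σ : Type*} {c : K} {p g : MvPolynomial σ K} {i j : σ →₀ ℕ}
    (hi : p.coeff i = 1) (hj : p.coeff j = c) {N : ℕ}
    (h : ∀ m, (p * g).coeff m ∈ poleSpace k c (N + 1)) (m : σ →₀ ℕ) :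
    g.coeff m ∈ poleSpace k c N := by
  intro V hV
  have h' : ∀ m, V.valuation ((p * g).coeff m) ≤ max 1 (V.valuation c) ^ N := by
    intro m
    have h1 := h m V hV
    rw [pow_succ] at h1
    exact le_of_mul_le_mul_right h1 (lt_max_of_lt_left zero_lt_one)
  have h1 := ValuationSubring.mul_le_of_forall_coeff_mul_le V h' i m
  have h2 := ValuationSubring.mul_le_of_forall_coeff_mul_le V h' j m
  rw [hi, map_one, one_mul] at h1
  rw [hj] at h2
  rcases le_total 1 (V.valuation c) with hc | hc
  · rw [max_eq_right hc] at h2 ⊢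
    rwa [mul_comm]
  · rwa [max_eq_left hc, mul_one, ← max_eq_left hc]

theorem exists_valuation_le_pow_of_mem_adjoin {a c : K} (ha : a ∈ Algebra.adjoin k {c}) :
    ∃ e : ℕ, ∀ V : ValuationSubring K, (∀ a : k, algebraMap k K a ∈ V) →
      V.valuation a ≤ max 1 (V.valuation c) ^ e := by
  induction ha using Algebra.adjoin_induction with
  | mem x hx =>
    rw [Set.mem_singleton_iff] at hx
    exact ⟨1, fun V _ ↦ by simp [hx]⟩
  | algebraMap r => exact ⟨0, fun V hV ↦ by simpa using (V.valuation_le_one_iff _).mpr (hV r)⟩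
  | add x y _ _ hx hy =>
    obtain ⟨e, he⟩ := hx
    obtain ⟨f, hf⟩ := hy
    refine ⟨max e f, fun V hV ↦ V.valuation.map_add_le ?_ ?_⟩
    · exact (he V hV).trans (pow_le_pow_right₀ (le_max_left _ _) (le_max_left _ _))
    · exact (hf V hV).trans (pow_le_pow_right₀ (le_max_left _ _) (le_max_right _ _))
  | mul x y _ _ hx hy =>
    obtain ⟨e, he⟩ := hx
    obtain ⟨f, hf⟩ := hy
    refine ⟨e + f, fun V hV ↦ ?_⟩
    rw [map_mul, pow_add]
    exact mul_le_mul' (he V hV) (hf V hV)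

theorem exists_valuation_le_pow_of_isIntegral {b c : K}
    (hb : IsIntegral (Algebra.adjoin k {c}) b) :
    ∃ e : ℕ, ∀ V : ValuationSubring K, (∀ a : k, algebraMap k K a ∈ V) →
      V.valuation b ≤ max 1 (V.valuation c) ^ e := by
  obtain ⟨q, hq, hqb⟩ := hb
  choose e he using fun i ↦ exists_valuation_le_pow_of_mem_adjoin (q.coeff i).2
  refine ⟨(Finset.range q.natDegree).sup e, fun V hV ↦ ?_⟩
  by_contra! hlt
  have hb1 : 1 < V.valuation b := (one_le_pow₀ (le_max_left _ _)).trans_lt hlt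
  have hb0 : 0 < V.valuation b := zero_lt_one.trans hb1
  rw [Polynomial.eval₂_eq_sum_range, Finset.sum_range_succ, hq.coeff_natDegree, map_one, one_mul,
    add_eq_zero_iff_neg_eq] at hqb
  have hsum : V.valuation (b ^ q.natDegree) < V.valuation b ^ q.natDegree := by
    rw [← hqb, Valuation.map_neg]
    refine V.valuation.map_sum_lt (pow_pos hb0 _).ne' fun i hi ↦ ?_
    rw [map_mul, map_pow]
    calc _ ≤ max 1 (V.valuation c) ^ (Finset.range q.natDegree).sup e * V.valuation b ^ i := by
          gcongr
          exact (he i V hV).trans (pow_le_pow_right₀ (le_max_left _ _) (Finset.le_sup hi))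
      _ < V.valuation b * V.valuation b ^ i := by
          exact mul_lt_mul_of_pos_right hlt (pow_pos hb0 _)
      _ ≤ V.valuation b ^ q.natDegree := by
          rw [← pow_succ']
          exact pow_le_pow_right₀ hb1.le (Finset.mem_range.mp hi)
  rw [map_pow] at hsum
  exact hsum.false

theorem exists_mul_pow_mem_poleSpace {b c : K} (hb : IsIntegral (Algebra.adjoin k {c}) b) :
    ∃ M, ∀ a, b * c ^ a ∈ poleSpace k c (a + M) := by
  obtain ⟨e, he⟩ := exists_valuation_le_pow_of_isIntegral hb
  refine ⟨e + 1, fun a V hV ↦ ?_⟩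
  rw [map_mul, map_pow, ← add_assoc, pow_succ, add_comm a e, pow_add]
  gcongr
  · exact he V hV
  · exact le_max_right _ _

end

universe u

section
attribute [local instance] MvPolynomial.algebraMvPolynomial

theorem algebraicIndependent_algebraMap_X {k L σ : Type*} (F : Type*) [Field k]
    [Field L] [Field F] [Algebra k L]
    [Algebra (MvPolynomial σ k) F] [IsFractionRing (MvPolynomial σ k) F]
    [Algebra (MvPolynomial σ k) L] [Algebra F L] [IsScalarTower (MvPolynomial σ k) F L]
    [IsScalarTower k (MvPolynomial σ k) L] :
    AlgebraicIndependent k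
      (fun i : σ ↦ algebraMap (MvPolynomial σ k) L (MvPolynomial.X i)) := by
  have haeval : MvPolynomial.aeval
      (fun i ↦ algebraMap (MvPolynomial σ k) L (MvPolynomial.X i)) =
      IsScalarTower.toAlgHom k (MvPolynomial σ k) L := by ext; simp
  rw [AlgebraicIndependent, haeval]
  change Function.Injective (algebraMap (MvPolynomial σ k) L)
  rw [IsScalarTower.algebraMap_eq (MvPolynomial σ k) F L]
  exact (algebraMap F L).injective.comp (IsFractionRing.injective _ F)

theorem mem_span_range_C_of_coeff_mem {k K σ ι : Type*} [Field k] [Field K] [Algebra k K]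
    {W : Submodule k K} {b : ι → K} (hb : W ≤ Submodule.span k (Set.range b))
    {g : MvPolynomial σ K} (hg : ∀ m, g.coeff m ∈ W) :
    g ∈ Submodule.span (MvPolynomial σ k)
      (Set.range fun i ↦ (MvPolynomial.C (b i) : MvPolynomial σ K)) := by
  classical
  rw [g.as_sum]
  refine Submodule.sum_mem _ fun m _ ↦ ?_
  have := hb (hg m)
  generalize g.coeff m = x at this
  induction this using Submodule.span_induction with
  | mem x hx =>
    obtain ⟨i, rfl⟩ := hx
    have : MvPolynomial.monomial m (b i) = MvPolynomial.monomial m (1 : k) •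
        (MvPolynomial.C (b i) : MvPolynomial σ K) := by
      rw [Algebra.smul_def, MvPolynomial.algebraMap_def, MvPolynomial.map_monomial, map_one,
        mul_comm, MvPolynomial.C_mul_monomial, mul_one]
    rw [this]
    exact Submodule.smul_mem _ _ (Submodule.subset_span ⟨i, rfl⟩)
  | zero => simp
  | add x y _ _ hx hy =>
    rw [map_add]
    exact add_mem hx hy
  | smul a x _ hx =>
    have : MvPolynomial.monomial m (a • x) = (MvPolynomial.C a : MvPolynomial σ k) •
        MvPolynomial.monomial m x := by
      rw [Algebra.smul_def, Algebra.smul_def, MvPolynomial.algebraMap_def, MvPolynomial.map_C,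
        MvPolynomial.C_mul_monomial]
    rw [this]
    exact Submodule.smul_mem _ _ hx

theorem injective_linearCombination_C {k K σ ι : Type*} [Field k] [Field K] [Algebra k K]
    [Fintype ι] {u : ι → K} (hu : LinearIndependent k u) :
    Function.Injective (Fintype.linearCombination (MvPolynomial σ k)
      fun i ↦ (MvPolynomial.C (u i) : MvPolynomial σ K)) := by
  rw [← LinearMap.ker_eq_bot, LinearMap.ker_eq_bot']
  intro r hr
  ext i m
  have h := congrArg (MvPolynomial.coeff m) hr
  rw [Fintype.linearCombination_apply, MvPolynomial.coeff_sum, MvPolynomial.coeff_zero] at h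
  refine Fintype.linearIndependent_iff.mp hu (fun i ↦ (r i).coeff m) ?_ i
  rw [← h]
  refine Finset.sum_congr rfl fun i _ ↦ ?_
  rw [Algebra.smul_def, Algebra.smul_def, MvPolynomial.algebraMap_def, mul_comm,
    mul_comm _ (MvPolynomial.C _), MvPolynomial.coeff_C_mul, MvPolynomial.coeff_map]

theorem aeval_linearCombination_C {k K L σ ι : Type*} [Field k] [Field K] [Field L] [Algebra k K]
    [Algebra K L] [Algebra (MvPolynomial σ k) L] [Algebra k L] [IsScalarTower k K L]
    [IsScalarTower k (MvPolynomial σ k) L] [Fintype ι] (u : ι → K) (r : ι → MvPolynomial σ k) :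
    MvPolynomial.aeval (fun i ↦ algebraMap (MvPolynomial σ k) L (MvPolynomial.X i))
      (Fintype.linearCombination (MvPolynomial σ k)
        (fun i ↦ (MvPolynomial.C (u i) : MvPolynomial σ K)) r) =
      Fintype.linearCombination (MvPolynomial σ k) (fun i ↦ algebraMap K L (u i)) r := by
  have haeval : MvPolynomial.aeval
      (fun i ↦ algebraMap (MvPolynomial σ k) L (MvPolynomial.X i)) =
      IsScalarTower.toAlgHom k (MvPolynomial σ k) L := by ext; simp
  simp only [Fintype.linearCombination_apply, map_sum, Algebra.smul_def, map_mul,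
    MvPolynomial.algebraMap_def, MvPolynomial.aeval_map_algebraMap, haeval]
  simp

theorem finrank_le_finrank_of_finiteDimensional {k K L σ : Type*} (F : Type*) [Field k] [Field K]
    [Field L] [Field F] [Algebra k K] [Algebra K L] [Algebra k L] [IsScalarTower k K L]
    [Algebra (MvPolynomial σ k) F] [IsFractionRing (MvPolynomial σ k) F]
    [Algebra (MvPolynomial σ k) L] [Algebra F L] [IsScalarTower (MvPolynomial σ k) F L]
    [IsScalarTower k (MvPolynomial σ k) L] [FiniteDimensional F L] [FiniteDimensional k K] :
    Module.finrank k K ≤ Module.finrank F L := by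
  let t : σ → L := fun i ↦ algebraMap (MvPolynomial σ k) L (MvPolynomial.X i)
  have ht : AlgebraicIndependent K t := (algebraicIndependent_algebraMap_X F).extendScalars K
  let b := Module.finBasis k K
  have hb : LinearIndependent (MvPolynomial σ k) fun i ↦ algebraMap K L (b i) := by
    rw [Fintype.linearIndependent_iff]
    intro r hr
    rw [← Fintype.linearCombination_apply, ← aeval_linearCombination_C] at hr
    exact congrFun (injective_linearCombination_C b.linearIndependent
      ((ht.eq_zero_of_aeval_eq_zero _ hr).trans (map_zero _).symm))
  have hbF := (LinearIndependent.iff_fractionRing (MvPolynomial σ k) F).mp hb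
  simpa using hbF.fintype_card_le_finrank

/-- A linear relation over `k[σ]` in `L` between elements of `poleSpace k c (N + 1)` yields a
multiple of `p`, whose cofactor has coefficients in `poleSpace k c N`. -/
theorem rank_poleSpace_le {k K L σ : Type u} [Field k] [Field K] [Field L] [Algebra k K]
    [Algebra K L] [Algebra (MvPolynomial σ k) L] [Algebra k L] [IsScalarTower k K L]
    [IsScalarTower k (MvPolynomial σ k) L]
    {c : K} (hc : Transcendental k c) {p : MvPolynomial σ K} {i j : σ →₀ ℕ}
    (hi : p.coeff i = 1) (hj : p.coeff j = c)
    (hp : ∀ q : MvPolynomial σ K, MvPolynomial.aeval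
      (fun i ↦ algebraMap (MvPolynomial σ k) L (MvPolynomial.X i)) q = 0 ↔ p ∣ q)
    {d : ℕ} (hd : Module.rank (MvPolynomial σ k) L ≤ d) (N : ℕ) :
    Module.rank k (poleSpace k c N) ≤ (N * d : ℕ) := by
  induction N with
  | zero => rw [poleSpace_zero hc]; simp
  | succ N ih =>
    refine rank_le fun s hs ↦ ?_
    let u : s → K := fun x ↦ (x : poleSpace k c (N + 1))
    have hu : LinearIndependent k u := hs.map' (poleSpace k c (N + 1)).subtype (by simp)
    let R := MvPolynomial σ k
    let φ : (s → R) →ₗ[R] L := Fintype.linearCombination R fun x ↦ algebraMap K L (u x)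
    let ψ : (s → R) →ₗ[R] MvPolynomial σ K :=
      Fintype.linearCombination R fun x ↦ MvPolynomial.C (u x)
    have hψ : Function.Injective ψ := injective_linearCombination_C hu
    let ev : MvPolynomial σ K →ₐ[K] L := MvPolynomial.aeval
      (fun i ↦ algebraMap (MvPolynomial σ k) L (MvPolynomial.X i))
    have hφψ : ∀ r, φ r = ev (ψ r) := fun r ↦ (aeval_linearCombination_C u r).symm
    have hψp : ∀ r, ∀ m, (ψ r).coeff m ∈ poleSpace k c (N + 1) := by
      intro r m
      rw [Fintype.linearCombination_apply, MvPolynomial.coeff_sum]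
      refine Submodule.sum_mem _ fun x _ ↦ ?_
      rw [Algebra.smul_def, MvPolynomial.algebraMap_def, mul_comm, MvPolynomial.coeff_C_mul,
        MvPolynomial.coeff_map, mul_comm, ← Algebra.smul_def]
      exact Submodule.smul_mem _ _ x.1.2
    let b := Module.Free.chooseBasis k (poleSpace k c N)
    let S : Set (MvPolynomial σ K) := Set.range fun x ↦ MvPolynomial.C (b x : K)
    have hS : (LinearMap.ker φ).map ψ ≤
        (Submodule.span R S).map (LinearMap.mulLeft R p) := by
      rintro _ ⟨r, hr, rfl⟩
      obtain ⟨g, hg⟩ := (hp (ψ r)).mp ((hφψ r).symm.trans hr)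
      refine ⟨g, ?_, hg.symm⟩
      refine mem_span_range_C_of_coeff_mem (W := poleSpace k c N) (fun x hx ↦ ?_)
        (coeff_mem_poleSpace hi hj fun m ↦ hg ▸ hψp r m)
      have := Submodule.mem_map_of_mem (f := (poleSpace k c N).subtype) (b.mem_span ⟨x, hx⟩)
      rw [Submodule.map_span, ← Set.range_comp] at this
      exact this
    have hker : Module.rank R (LinearMap.ker φ) ≤ (N * d : ℕ) := by
      rw [(Submodule.equivMapOfInjective ψ hψ _).rank_eq]
      refine (Submodule.rank_mono hS).trans ((rank_map_le _ _).trans ((rank_span_le S).trans ?_))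
      exact Cardinal.mk_range_le.trans
        ((Module.Free.rank_eq_card_chooseBasisIndex k _).symm.le.trans ih)
    have hrange : Module.rank R (LinearMap.range φ) ≤ d := (Submodule.rank_le _).trans hd
    have h := LinearMap.rank_range_add_rank_ker φ
    rw [rank_fun', Fintype.card_coe] at h
    have : ((s.card : ℕ) : Cardinal.{u}) ≤ (d + N * d : ℕ) := by
      rw [← h, Nat.cast_add]
      exact add_le_add hrange hker
    rw [Nat.cast_le] at this
    rw [add_mul, one_mul]
    omega
end

theorem exists_coeff_eq_one_and_transcendental_coeff {k K L σ : Type*} [Field k] [Field K]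
    [Field L] [Algebra k K] [Algebra K L] [Algebra k L] [IsScalarTower k K L]
    (htr : ∀ x : K, Transcendental k x → Algebra.IsAlgebraic (Algebra.adjoin k {x}) K)
    {t : σ → L} (ht : AlgebraicIndependent k t) (hnt : ¬ AlgebraicIndependent K t) :
    ∃ (p : MvPolynomial σ K) (i j : σ →₀ ℕ), p.coeff i = 1 ∧ Transcendental k (p.coeff j) ∧
      ∀ q, MvPolynomial.aeval t q = 0 ↔ p ∣ q := by
  obtain ⟨p, hp, hpq⟩ := exists_dvd_iff_aeval_eq_zero htr ht hnt
  obtain ⟨i, hi⟩ := MvPolynomial.ne_zero_iff.mp hp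
  have hu : IsUnit (MvPolynomial.C (p.coeff i)⁻¹ : MvPolynomial σ K) :=
    (inv_ne_zero hi).isUnit.map MvPolynomial.C
  have hdvd : ∀ q, MvPolynomial.aeval t q = 0 ↔ MvPolynomial.C (p.coeff i)⁻¹ * p ∣ q := by
    intro q
    rw [hpq, hu.mul_left_dvd]
  have h1 : (MvPolynomial.C (p.coeff i)⁻¹ * p).coeff i = 1 := by
    rw [MvPolynomial.coeff_C_mul, inv_mul_cancel₀ hi]
  generalize MvPolynomial.C (p.coeff i)⁻¹ * p = p' at hdvd h1
  suffices ∃ j, Transcendental k (p'.coeff j) by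
    obtain ⟨j, hj⟩ := this
    exact ⟨p', i, j, h1, hj, hdvd⟩
  by_contra! hall
  have hmem : p' ∈ Set.range (MvPolynomial.map (σ := σ) (algebraMap (algebraicClosure k K) K)) := by
    rw [MvPolynomial.mem_range_map_iff_coeffs_subset]
    intro x hx
    obtain ⟨m, -, rfl⟩ := MvPolynomial.mem_coeffs_iff.mp hx
    exact ⟨⟨p'.coeff m, mem_algebraicClosure_iff.mpr (not_not.mp (hall m))⟩, rfl⟩
  obtain ⟨r, rfl⟩ := hmem
  have hr : MvPolynomial.aeval t r = 0 := by
    rw [← MvPolynomial.aeval_map_algebraMap K, hdvd]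
  have := (ht.extendScalars (algebraicClosure k K)).eq_zero_of_aeval_eq_zero r hr
  simp [this] at h1

theorem rank_adjoin_le_of_rank_poleSpace_le {k K : Type u} [Field k] [Field K] [Algebra k K]
    {c : K} (hc : Transcendental k c) (halg : Algebra.IsAlgebraic (Algebra.adjoin k {c}) K) {d : ℕ}
    (hd : ∀ N, Module.rank k (poleSpace k c N) ≤ (N * d : ℕ)) :
    Module.rank k⟮c⟯ K ≤ d := by
  refine rank_le fun s hs ↦ ?_
  choose y hy0 hy using fun x : s ↦
    (Algebra.IsAlgebraic.isAlgebraic (R := Algebra.adjoin k {c}) (x : K)).exists_integral_multiple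
  choose M hM using fun x ↦ exists_mul_pow_mem_poleSpace (hy x)
  let M' := Finset.univ.sup M
  have hpow : ∀ N, LinearIndependent k
      (fun a : Fin N ↦ (AdjoinSimple.gen k c) ^ (a : ℕ)) := by
    intro N
    have hinj : Function.Injective (Polynomial.aeval (R := k) (AdjoinSimple.gen k c)) := by
      rw [← transcendental_iff_injective]
      rw [← AdjoinSimple.algebraMap_gen k c] at hc
      exact transcendental_algebraMap_iff (FaithfulSMul.algebraMap_injective _ _) |>.mp hc
    have := (Polynomial.basisMonomials k).linearIndependent.map'
      (Polynomial.aeval (R := k) (AdjoinSimple.gen k c)).toLinearMap (LinearMap.ker_eq_bot.mpr hinj)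
    have hfun : (fun a : Fin N ↦ (AdjoinSimple.gen k c) ^ (a : ℕ)) =
        ((Polynomial.aeval (R := k) (AdjoinSimple.gen k c)).toLinearMap ∘
          Polynomial.basisMonomials k) ∘ (fun a : Fin N ↦ (a : ℕ)) := by
      ext a
      simp
    rw [hfun]
    exact this.comp _ Fin.val_injective
  have hb : LinearIndependent k⟮c⟯ (fun x : s ↦ y x • (x : K)) := by
    have hmem : ∀ x, (y x : K) ∈ k⟮c⟯ := fun x ↦
      algebra_adjoin_le_adjoin k _ (y x).2
    exact hs.units_smul fun x ↦ Units.mk0 (⟨y x, hmem x⟩ : k⟮c⟯)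
      (fun h ↦ hy0 x (Subtype.ext (congrArg (algebraMap k⟮c⟯ K) h)))
  have key : ∀ N, N * s.card ≤ (N + M') * d := by
    intro N
    have h1 := linearIndependent_smul (hpow N) hb
    have h2 : ∀ z : Fin N × s, (AdjoinSimple.gen k c) ^ (z.1 : ℕ) • (y z.2 • (z.2 : K)) ∈
        poleSpace k c (N + M') := by
      intro z
      have := hM z.2 z.1
      rw [mul_comm] at this
      exact poleSpace_mono c (add_le_add z.1.2.le (Finset.le_sup (Finset.mem_univ z.2))) this
    have h3 : LinearIndependent k (fun z ↦ (⟨_, h2 z⟩ : poleSpace k c (N + M'))) :=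
      LinearIndependent.of_comp (poleSpace k c (N + M')).subtype h1
    have h4 := h3.cardinal_lift_le_rank
    rw [Cardinal.mk_fintype, Fintype.card_prod, Fintype.card_fin, Fintype.card_coe,
      Cardinal.lift_natCast] at h4
    have h5 := h4.trans (Cardinal.lift_le.mpr (hd _))
    rwa [Cardinal.lift_natCast, Nat.cast_le] at h5
  by_contra! hlt
  have := key (M' * d + 1)
  nlinarith [Nat.mul_le_mul_left (M' * d + 1) hlt]

/-- If a curve with function field `K` is dominated by a degree `d` cover of an affine space,
then it has a nonconstant rational function of degree at most `d`. -/
theorem exists_transcendental_rank_adjoin_le {k K L σ : Type u} (F : Type u) [Field k] [Field K]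
    [Field L] [Field F] [Algebra k K] [Algebra K L] [Algebra k L] [IsScalarTower k K L]
    [Algebra (MvPolynomial σ k) F] [IsFractionRing (MvPolynomial σ k) F]
    [Algebra (MvPolynomial σ k) L] [Algebra F L] [IsScalarTower (MvPolynomial σ k) F L]
    [IsScalarTower k (MvPolynomial σ k) L] [FiniteDimensional F L]
    (htr : ∀ x : K, Transcendental k x → Algebra.IsAlgebraic (Algebra.adjoin k {x}) K)
    (hK : ∃ x : K, Transcendental k x) :
    ∃ c : K, Transcendental k c ∧ Module.rank k⟮c⟯ K ≤ Module.finrank F L := by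
  let t : σ → L := fun i ↦ algebraMap (MvPolynomial σ k) L (MvPolynomial.X i)
  have haeval : MvPolynomial.aeval t = IsScalarTower.toAlgHom k (MvPolynomial σ k) L := by
    ext; simp [t]
  have ht : AlgebraicIndependent k t := algebraicIndependent_algebraMap_X F
  have hnt : ¬ AlgebraicIndependent K t := by
    intro h
    obtain ⟨x, hx⟩ := hK
    have h1 : AlgebraicIndependent k (fun _ : Unit ↦ x) :=
      algebraicIndependent_unique_type_iff.mpr hx
    have h2 := (h1.sumElim_comp h).comp Sum.swap Sum.swap_leftInverse.injective
    have hswap : Sum.elim t (algebraMap K L ∘ fun _ : Unit ↦ x) ∘ Sum.swap =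
        Sum.elim (algebraMap K L ∘ fun _ : Unit ↦ x) t := by
      ext (_ | _) <;> rfl
    rw [hswap, AlgebraicIndependent.sumElim_iff] at h2
    refine algebraicIndependent_unique_type_iff.mp h2.2 ?_
    have hx' : IsAlgebraic (MvPolynomial σ k) (algebraMap K L x) :=
      (IsFractionRing.isAlgebraic_iff _ F L).mpr (Algebra.IsAlgebraic.isAlgebraic _)
    refine (isAlgebraic_ringHom_iff_of_comp_eq ht.aevalEquiv (RingHom.id L)
      Function.injective_id ?_).mpr hx'
    refine RingHom.ext fun r ↦ ?_
    exact (ht.algebraMap_aevalEquiv r).trans (DFunLike.congr_fun haeval r)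
  obtain ⟨p, i, j, hi, hj, hp⟩ := exists_coeff_eq_one_and_transcendental_coeff htr ht hnt
  refine ⟨p.coeff j, hj, rank_adjoin_le_of_rank_poleSpace_le hj (htr _ hj) ?_⟩
  refine rank_poleSpace_le (L := L) hj hi rfl hp ?_
  rw [← IsFractionRing.rank_right_eq _ F, Module.finrank_eq_rank]

theorem DimLE.isAlgebraic_adjoin {k K : Type} [Field k] [Field K] [Algebra k K]
    (h : DimLE k K 1) {x : K} (hx : Transcendental k x) :
    Algebra.IsAlgebraic (Algebra.adjoin k {x}) K := by
  obtain ⟨s, hs, halg⟩ := h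
  rw [IntermediateField.isAlgebraic_adjoin_iff_top] at halg
  have h1 : Algebra.trdeg k K ≤ Cardinal.mk Unit := by
    refine (Algebra.IsAlgebraic.trdeg_le_cardinalMk k (s : Set K)).trans ?_
    simpa using hs
  have h2 : AlgebraicIndependent k (fun _ : Unit ↦ x) :=
    algebraicIndependent_unique_type_iff.mpr hx
  have h3 := (h2.isTranscendenceBasis_of_trdeg_le_of_finite h1).isAlgebraic
  rw [Set.range_const] at h3
  exact h3

theorem IsFunctionField.finiteDimensional {k K : Type} [Field k] [Field K] [Algebra k K]
    (h : IsFunctionField k K) (halg : Algebra.IsAlgebraic k K) : FiniteDimensional k K := by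
  obtain ⟨s, hs⟩ := h
  have : FiniteDimensional k (IntermediateField.adjoin k (s : Set K)) :=
    IntermediateField.finiteDimensional_adjoin fun x _ ↦ Algebra.IsIntegral.isIntegral x
  rw [hs] at this
  exact Module.Finite.equiv IntermediateField.topEquiv.toLinearEquiv

/-- The affine space over `k` with coordinates indexed by `G`, with `G` permuting the coordinates
by left translation. -/
noncomputable def GVariety.regular (k : Type) [Field k] (G : Type) [Group G] [Finite G] :
    GVariety k G where
  K := FractionRing (MvPolynomial G k)
  fg := by
    have := Fintype.ofFinite G
    classical
    let f : MvPolynomial G k →ₐ[k] FractionRing (MvPolynomial G k) := IsScalarTower.toAlgHom k _ _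
    refine ⟨Finset.univ.image fun g ↦ f (MvPolynomial.X g), eq_top_iff.mpr fun z _ ↦ ?_⟩
    have hmem : ∀ q, f q ∈ IntermediateField.adjoin k
        ((Finset.univ.image fun g ↦ f (MvPolynomial.X g) : Finset _) : Set _) := by
      intro q
      induction q using MvPolynomial.induction_on with
      | C a => exact IntermediateField.algebraMap_mem _ a
      | add p q hp hq => rw [map_add]; exact add_mem hp hq
      | mul_X p i hp =>
        rw [map_mul]
        exact mul_mem hp (IntermediateField.subset_adjoin _ _ (by simp))
    obtain ⟨a, b, -, rfl⟩ := IsFractionRing.div_surjective (A := MvPolynomial G k) z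
    exact div_mem (hmem a) (hmem b)
  action := (IsFractionRing.fieldEquivOfAlgEquivHom k (FractionRing (MvPolynomial G k))).comp
    { toFun g := MvPolynomial.renameEquiv k (Equiv.mulLeft g)
      map_one' := by ext; simp
      map_mul' g h := by ext; simp [mul_assoc] }
  faithful := by
    refine (IsFractionRing.fieldEquivOfAlgEquivHom_injective k _ k _).comp fun g h hgh ↦ ?_
    have := DFunLike.congr_fun hgh (MvPolynomial.X 1)
    simpa [MvPolynomial.X_injective.eq_iff] using this

/-- Let `k` be a perfect field, `n ≥ 1`, and `G` a finite group with:
(1) `ed_k(G; ≤ n) = 1`; (2) `G` has no proper subgroup of index at most `n`; and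
(3) `G` contains a subgroup `M` embedding in `PSL₂(k)` with `|M| > n`.  Then there
is a smooth irreducible projective faithful `G`-curve `C̃` over `k` (given
birationally by its function field) with a rational function `f : C̃ → P¹` of
degree `m` for some `m ≤ n`. -/
theorem exists_faithful_G_curve_with_small_gonality (k : Type) [Field k] [PerfectField k]
    (n : ℕ) (hn : 1 ≤ n) (G : Type) [Group G] [Finite G]
    (hed : EDLE k G n 1)
    (hindex : ∀ H : Subgroup G, H ≠ ⊤ → n < H.index)
    (hM : ∃ M : Subgroup G, n < Nat.card M ∧
      ∃ e : M →* Matrix.ProjectiveSpecialLinearGroup (Fin 2) k, Function.Injective e) :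
    ∃ C : GVariety k G, IsCurveField k C.K ∧
      ∃ (f : C.K) (m : ℕ), 1 ≤ m ∧ m ≤ n ∧ RatFnDegree k C.K f m := by
  obtain ⟨T, Y, ⟨(ι : FractionRing (MvPolynomial G k) →ₐ[k] T.K), hfin, hdeg, -⟩, ⟨φ, -⟩, hdim⟩ :=
    hed (GVariety.regular k G)
  let R := MvPolynomial G k
  let F := FractionRing R
  let : Algebra F T.K := ι.toRingHom.toAlgebra
  let : Algebra R T.K := (ι.toRingHom.comp (algebraMap R F)).toAlgebra
  let : Algebra Y.K T.K := φ.toRingHom.toAlgebra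
  have : IsScalarTower k Y.K T.K := IsScalarTower.of_algebraMap_eq fun a ↦ (φ.commutes a).symm
  have : IsScalarTower R F T.K := IsScalarTower.of_algebraMap_eq fun _ ↦ rfl
  have : IsScalarTower k R T.K := IsScalarTower.of_algebraMap_eq fun a ↦ (ι.commutes a).symm
  let e : ι.fieldRange ≃+* F := (AlgEquiv.ofInjectiveField ι).symm.toRingEquiv
  have he : (algebraMap F T.K).comp e.toRingHom =
      (RingEquiv.refl T.K).toRingHom.comp (algebraMap ι.fieldRange T.K) := by
    refine RingHom.ext fun x ↦ ?_
    exact congrArg Subtype.val ((AlgEquiv.ofInjectiveField ι).apply_symm_apply x)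
  have : FiniteDimensional ι.fieldRange T.K := hfin
  have : FiniteDimensional F T.K := Module.Finite.of_equiv_equiv e (RingEquiv.refl T.K) he
  have hdeg' : Module.finrank F T.K ≤ n :=
    (Algebra.finrank_eq_of_equiv_equiv e (RingEquiv.refl T.K) he).symm.trans_le hdeg
  have htrans : ∃ x : Y.K, Transcendental k x := by
    by_contra! halg
    have : FiniteDimensional k Y.K :=
      Y.fg.finiteDimensional ⟨fun x ↦ not_not.mp (halg x)⟩
    obtain ⟨M, hM, -⟩ := hM
    have h1 : Nat.card G ≤ Module.finrank k Y.K :=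
      (Nat.card_le_card_of_injective _ Y.faithful).trans
        (Nat.card_eq_fintype_card.trans_le (AlgEquiv.card_le))
    have h2 : Module.finrank k Y.K ≤ Module.finrank F T.K :=
      finrank_le_finrank_of_finiteDimensional (σ := G) F
    have h3 : Nat.card M ≤ Nat.card G := M.card_le_card_group
    omega
  obtain ⟨c, -, hrank⟩ := exists_transcendental_rank_adjoin_le (σ := G) (L := T.K) F
    (fun x hx ↦ hdim.isAlgebraic_adjoin hx) htrans
  have : FiniteDimensional k⟮c⟯ Y.K :=
    Module.rank_lt_aleph0_iff.mp (hrank.trans_lt (Cardinal.natCast_lt_aleph0))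
  refine ⟨Y, ⟨Y.fg, hdim, htrans⟩, c, Module.finrank k⟮c⟯ Y.K, Module.finrank_pos, ?_, this, rfl⟩
  exact (Module.finrank_le_of_rank_le hrank).trans hdeg'
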